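/- Induction principle for open terms: let P = (Σ,E) be an S-sorted second-order presentation, (Y, ⟦–⟧) a P-algebra, and (Q(Γ;A) ⊆ Y(Γ;A)) a family of subsets (not assumed closed under substitution). Define Q^∘(Γ;A) = { t ∈ Y(Γ;A) | for every context Δ and every σ ∈ Y(Δ;Γ) with σ_j ∈ Q(Δ;Γ_j) for all j, t[σ] ∈ Q(Δ;A) }. If, for a clone homomorphism f : X → Y, (i) var^Γ_i ∈ Q(Γ;Γ_i) for every context Γ and i, (ii) for every operator o ∈ Σ((Δ₁;A₁),…,(Δₙ;Aₙ);B), context Γ, and t_i ∈ Q^∘(Γ,Δ_i;A_i), ⟦o⟧_Γ(t₁,…,tₙ) ∈ Q^∘(Γ;B), and (iii) f_{Γ;B}(t) ∈ Q^∘(Γ;B) for every t ∈ X(Γ;B), then f̂_{Γ;A}(t) ∈ Q(Γ;A) for every free term t ∈ (F_P X)(Γ;A). -/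

import Mathlib

/-- Data of an `S`-sorted abstract clone: term sets, variables, substitution. -/
structure CloneData (S : Type) : Type 1 where
  T : List S → S → Type
  varC : (Γ : List S) → (i : Fin Γ.length) → T Γ (Γ.get i)
  substC : {Γ Δ : List S} → {A : S} → T Δ A → ((i : Fin Δ.length) → T Γ (Δ.get i)) → T Γ A

namespace CloneData

variable {S : Type}

/-- Substitutions `σ ∈ X(Γ;Δ)`. -/
abbrev Sub (X : CloneData S) (Γ Δ : List S) : Type := (i : Fin Δ.length) → X.T Γ (Δ.get i)

def castT (X : CloneData S) {Γ : List S} {A B : S} (h : A = B) (t : X.T Γ A) : X.T Γ B := h ▸ t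

def castCtx (X : CloneData S) {Γ Γ' : List S} {A : S} (h : Γ = Γ') (t : X.T Γ A) : X.T Γ' A :=
  h ▸ t

end CloneData

/-- The three clone laws. -/
def IsClone {S : Type} (X : CloneData S) : Prop :=
  (∀ (Γ Δ : List S) (i : Fin Δ.length) (σ : X.Sub Γ Δ), X.substC (X.varC Δ i) σ = σ i) ∧
  (∀ (Γ : List S) (A : S) (t : X.T Γ A), X.substC t (X.varC Γ) = t) ∧
  (∀ (Γ Δ Ξ : List S) (A : S) (t : X.T Ξ A) (σ' : X.Sub Δ Ξ) (σ : X.Sub Γ Δ),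
    X.substC t (fun i => X.substC (σ' i) σ) = X.substC (X.substC t σ') σ)

/-- Clone homomorphisms: families of maps preserving variables and substitution. -/
def IsCloneHom {S : Type} (X Y : CloneData S) (f : ∀ (Γ : List S) (A : S), X.T Γ A → Y.T Γ A) :
    Prop :=
  (∀ (Γ : List S) (i : Fin Γ.length), f Γ (Γ.get i) (X.varC Γ i) = Y.varC Γ i) ∧
  (∀ (Γ Δ : List S) (A : S) (t : X.T Δ A) (σ : X.Sub Γ Δ),
    f Γ A (X.substC t σ) = Y.substC (f Δ A t) (fun i => f Γ (Δ.get i) (σ i)))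
namespace CloneAux

theorem get_append_left {α : Type} (Γ Ξ : List α) {j : ℕ} (h : j < Γ.length)
    (h2 : j < (Γ ++ Ξ).length) : (Γ ++ Ξ).get ⟨j, h2⟩ = Γ.get ⟨j, h⟩ := by
  simp [List.get_eq_getElem, List.getElem_append_left, h]

theorem get_append_right {α : Type} (Γ Ξ : List α) {j : ℕ} (h : ¬ j < Γ.length)
    (h2 : j < (Γ ++ Ξ).length) (h3 : j - Γ.length < Ξ.length) :
    (Γ ++ Ξ).get ⟨j, h2⟩ = Ξ.get ⟨j - Γ.length, h3⟩ := by
  simp only [List.get_eq_getElem]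
  rw [List.getElem_append_right (by omega)]

theorem sub_lt_of_append {α : Type} {Γ Ξ : List α} {j : ℕ} (h : ¬ j < Γ.length)
    (h2 : j < (Γ ++ Ξ).length) : j - Γ.length < Ξ.length := by
  simp only [List.length_append] at h2; omega

theorem add_lt_append {α : Type} (Γ Ξ : List α) {j : ℕ} (h : j < Ξ.length) :
    Γ.length + j < (Γ ++ Ξ).length := by
  simp only [List.length_append]; omega

theorem get_append_add {α : Type} (Γ Ξ : List α) {j : ℕ} (h : j < Ξ.length)
    (h2 : Γ.length + j < (Γ ++ Ξ).length) :
    (Γ ++ Ξ).get ⟨Γ.length + j, h2⟩ = Ξ.get ⟨j, h⟩ := by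
  simp only [List.get_eq_getElem]
  rw [List.getElem_append_right (by omega)]
  congr 1; omega

theorem le_append_length {α : Type} (Γ Ξ : List α) : Γ.length ≤ (Γ ++ Ξ).length := by
  simp [List.length_append]

end CloneAux
namespace CloneData

variable {S : Type}

/-- The weakening substitution `▷ wk^Γ_Ξ ∈ X(Γ,Ξ;Γ)`: the first `|Γ|` variables of `Γ ++ Ξ`. -/
def wkVar (X : CloneData S) (Γ Ξ : List S) : X.Sub (Γ ++ Ξ) Γ := fun i =>
  X.castT (CloneAux.get_append_left Γ Ξ i.isLt _)
    (X.varC (Γ ++ Ξ) ⟨(i : ℕ), lt_of_lt_of_le i.isLt (CloneAux.le_append_length Γ Ξ)⟩)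

/-- Extend a substitution `σ ∈ X(Γ,Ξ;Δ)` to `X(Γ,Ξ;Δ,Ξ)`, sending the extra variables of `Ξ`
to the corresponding variables of `Γ,Ξ`. -/
def extSub (X : CloneData S) (Ξ Γ Δ : List S)
    (σ : (i : Fin Δ.length) → X.T (Γ ++ Ξ) (Δ.get i)) : X.Sub (Γ ++ Ξ) (Δ ++ Ξ) := fun j =>
  if h : (j : ℕ) < Δ.length then
    X.castT (CloneAux.get_append_left Δ Ξ h j.isLt).symm (σ ⟨(j : ℕ), h⟩)
  else
    X.castT
      ((CloneAux.get_append_add Γ Ξ (CloneAux.sub_lt_of_append h j.isLt) _).trans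
        (CloneAux.get_append_right Δ Ξ h j.isLt (CloneAux.sub_lt_of_append h j.isLt)).symm)
      (X.varC (Γ ++ Ξ)
        ⟨Γ.length + ((j : ℕ) - Δ.length),
          CloneAux.add_lt_append Γ Ξ (CloneAux.sub_lt_of_append h j.isLt)⟩)

/-- The context extension `⟨Ξ⟩X`, with `(⟨Ξ⟩X)(Γ;A) = X(Γ,Ξ;A)`. -/
def ext (X : CloneData S) (Ξ : List S) : CloneData S where
  T Γ A := X.T (Γ ++ Ξ) A
  varC Γ i := X.wkVar Γ Ξ i
  substC {Γ Δ A} t σ := X.substC t (X.extSub Ξ Γ Δ σ)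

/-- The weakening map `wk^Ξ_X : X → ⟨Ξ⟩X`, sending `t` to `t[▷wk^Γ_Ξ]`. -/
def wkHom (X : CloneData S) (Ξ : List S) (Γ : List S) (A : S) (t : X.T Γ A) :
    (X.ext Ξ).T Γ A :=
  X.substC t (X.wkVar Γ Ξ)

end CloneData
namespace CloneData

/-- Lift a substitution `σ ∈ Y(Ξ;Γ)` to `σ↑Δ ∈ Y(Ξ,Δ;Γ,Δ)`: weaken the terms of `σ` and send
the extra variables of `Δ` to the corresponding variables of `Ξ,Δ`. -/
def liftSub {S : Type} (Y : CloneData S) {Ξ Γ : List S} (σ : Y.Sub Ξ Γ) (Δ : List S) :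
    Y.Sub (Ξ ++ Δ) (Γ ++ Δ) := fun j =>
  if h : (j : ℕ) < Γ.length then
    Y.castT (CloneAux.get_append_left Γ Δ h j.isLt).symm
      (Y.substC (σ ⟨(j : ℕ), h⟩) (Y.wkVar Ξ Δ))
  else
    Y.castT
      ((CloneAux.get_append_add Ξ Δ (CloneAux.sub_lt_of_append h j.isLt) _).trans
        (CloneAux.get_append_right Γ Δ h j.isLt (CloneAux.sub_lt_of_append h j.isLt)).symm)
      (Y.varC (Ξ ++ Δ)
        ⟨Ξ.length + ((j : ℕ) - Γ.length),
          CloneAux.add_lt_append Ξ Δ (CloneAux.sub_lt_of_append h j.isLt)⟩)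

end CloneData
/-- Metavariable contexts: lists of (context, sort) pairs. -/
abbrev MCtx (S : Type) : Type := List (List S × S)

/-- An `S`-sorted second-order signature: a set of operators for each second-order arity. -/
structure SOSig (S : Type) : Type 1 where
  ops : MCtx S → S → Type

/-- Second-order terms over a signature, in a metavariable context `Ψ` and variable context:
variables, metavariable applications, and operator applications (binding variables). -/
inductive SOTerm {S : Type} (Sg : SOSig S) (Ψ : MCtx S) : List S → S → Type
  | var {Γ : List S} (i : Fin Γ.length) : SOTerm Sg Ψ Γ (Γ.get i)
  | mvar {Γ : List S} (k : Fin Ψ.length)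
      (args : (i : Fin (Ψ.get k).1.length) → SOTerm Sg Ψ Γ ((Ψ.get k).1.get i)) :
      SOTerm Sg Ψ Γ ((Ψ.get k).2)
  | op {Γ : List S} {Φ : MCtx S} {B : S} (o : Sg.ops Φ B)
      (args : (i : Fin Φ.length) → SOTerm Sg Ψ (Γ ++ (Φ.get i).1) ((Φ.get i).2)) :
      SOTerm Sg Ψ Γ B

/-- An `S`-sorted second-order presentation: a signature with sets of equations between
second-order terms (in empty variable context). -/
structure SOPres (S : Type) extends SOSig S : Type 1 where
  eqs : (Ψ : MCtx S) → (B : S) → Set (SOTerm toSOSig Ψ [] B × SOTerm toSOSig Ψ [] B)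

/-- An interpretation of the operators of a second-order signature in a clone `Y`. -/
def OpInterp {S : Type} (Sg : SOSig S) (Y : CloneData S) : Type :=
  ∀ (Φ : MCtx S) (B : S), Sg.ops Φ B → ∀ (Γ : List S),
    ((i : Fin Φ.length) → Y.T (Γ ++ (Φ.get i).1) ((Φ.get i).2)) → Y.T Γ B

/-- The interpretations of operators commute with substitution (the `Σ`-algebra condition). -/
def OpsCommute {S : Type} {Sg : SOSig S} (Y : CloneData S) (I : OpInterp Sg Y) : Prop :=
  ∀ (Φ : MCtx S) (B : S) (o : Sg.ops Φ B) (Γ Ξ : List S) (σ : Y.Sub Ξ Γ)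
    (ts : (i : Fin Φ.length) → Y.T (Γ ++ (Φ.get i).1) ((Φ.get i).2)),
    Y.substC (I Φ B o Γ ts) σ = I Φ B o Ξ (fun i => Y.substC (ts i) (Y.liftSub σ (Φ.get i).1))

/-- The interpretation `⟦t⟧_Γ` of a second-order term in a `Σ`-algebra, given values of its
metavariables. -/
def semSO {S : Type} {Sg : SOSig S} (Y : CloneData S) (I : OpInterp Sg Y) {Ψ : MCtx S}
    (Γ : List S) (ρ : (k : Fin Ψ.length) → Y.T (Γ ++ (Ψ.get k).1) ((Ψ.get k).2)) :
    {Ξ : List S} → {B : S} → SOTerm Sg Ψ Ξ B → Y.T (Γ ++ Ξ) B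
  | Ξ, _, SOTerm.var i =>
      Y.castT (CloneAux.get_append_add Γ Ξ i.isLt _)
        (Y.varC (Γ ++ Ξ) ⟨Γ.length + (i : ℕ), CloneAux.add_lt_append Γ Ξ i.isLt⟩)
  | Ξ, _, SOTerm.mvar k args =>
      Y.substC (ρ k) (fun j =>
        if h : (j : ℕ) < Γ.length then
          Y.castT
            ((CloneAux.get_append_left Γ Ξ h
                (lt_of_lt_of_le h (CloneAux.le_append_length Γ Ξ))).trans
              (CloneAux.get_append_left Γ (Ψ.get k).1 h j.isLt).symm)
            (Y.varC (Γ ++ Ξ) ⟨(j : ℕ), lt_of_lt_of_le h (CloneAux.le_append_length Γ Ξ)⟩)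
        else
          Y.castT
            (CloneAux.get_append_right Γ (Ψ.get k).1 h j.isLt
              (CloneAux.sub_lt_of_append h j.isLt)).symm
            (semSO Y I Γ ρ (args ⟨(j : ℕ) - Γ.length, CloneAux.sub_lt_of_append h j.isLt⟩)))
  | Ξ, _, SOTerm.op o args =>
      I _ _ o (Γ ++ Ξ)
        (fun i => Y.castCtx (List.append_assoc Γ Ξ _).symm (semSO Y I Γ ρ (args i)))

/-- A `(Σ,E)`-algebra additionally satisfies the equations of the presentation. -/
def SatisfiesEqs {S : Type} (P : SOPres S) (Y : CloneData S) (I : OpInterp P.toSOSig Y) :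
    Prop :=
  ∀ (Ψ : MCtx S) (B : S) (t u : SOTerm P.toSOSig Ψ [] B), (t, u) ∈ P.eqs Ψ B →
    ∀ (Γ : List S) (ρ : (k : Fin Ψ.length) → Y.T (Γ ++ (Ψ.get k).1) ((Ψ.get k).2)),
      semSO Y I Γ ρ t = semSO Y I Γ ρ u

/-- Homomorphisms of `Σ`-algebras: clone homomorphisms preserving the operators. -/
def IsAlgHom {S : Type} {Sg : SOSig S} (X Y : CloneData S) (IX : OpInterp Sg X)
    (IY : OpInterp Sg Y) (f : ∀ (Γ : List S) (A : S), X.T Γ A → Y.T Γ A) : Prop :=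
  IsCloneHom X Y f ∧
  ∀ (Φ : MCtx S) (B : S) (o : Sg.ops Φ B) (Γ : List S)
    (ts : (i : Fin Φ.length) → X.T (Γ ++ (Φ.get i).1) ((Φ.get i).2)),
    f Γ B (IX Φ B o Γ ts) = IY Φ B o Γ (fun i => f _ _ (ts i))
/-- A predicate over a clone `Y`: a family of subsets containing all variables and closed
under substitution. -/
def IsPredicate {S : Type} (Y : CloneData S) (Q : ∀ (Γ : List S) (A : S), Set (Y.T Γ A)) :
    Prop :=
  (∀ (Γ : List S) (i : Fin Γ.length), Y.varC Γ i ∈ Q Γ (Γ.get i)) ∧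
  (∀ (Γ Δ : List S) (B : S) (t : Y.T Δ B) (σ : Y.Sub Γ Δ),
    t ∈ Q Δ B → (∀ j, σ j ∈ Q Γ (Δ.get j)) → Y.substC t σ ∈ Q Γ B)

/-- `F` together with `η : X → F` is the free `P`-algebra on `X`. -/
def IsFreeAlgebra {S : Type} (P : SOPres S) (X : CloneData S) (F : CloneData S)
    (IF : OpInterp P.toSOSig F) (η : ∀ (Γ : List S) (A : S), X.T Γ A → F.T Γ A) : Prop :=
  IsClone F ∧ OpsCommute F IF ∧ SatisfiesEqs P F IF ∧ IsCloneHom X F η ∧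
  ∀ (Y : CloneData S) (IY : OpInterp P.toSOSig Y),
    IsClone Y → OpsCommute Y IY → SatisfiesEqs P Y IY →
    ∀ f : ∀ (Γ : List S) (A : S), X.T Γ A → Y.T Γ A, IsCloneHom X Y f →
      ∃! g : ∀ (Γ : List S) (A : S), F.T Γ A → Y.T Γ A,
        IsAlgHom F Y IF IY g ∧ ∀ (Γ : List S) (A : S) (t : X.T Γ A),
          g Γ A (η Γ A t) = f Γ A t

/-- `Q^∘(Γ;A)`: terms all of whose instantiations by substitutions of terms in `Q` land
in `Q`. -/
def openLift {S : Type} (Y : CloneData S) (Q : ∀ (Γ : List S) (A : S), Set (Y.T Γ A))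
    (Γ : List S) (A : S) : Set (Y.T Γ A) :=
  {t | ∀ (Δ : List S) (σ : Y.Sub Δ Γ), (∀ j, σ j ∈ Q Δ (Γ.get j)) → Y.substC t σ ∈ Q Δ A}

namespace CloneData

variable {S : Type} {X Y : CloneData S} (f : ∀ (Γ : List S) (A : S), X.T Γ A → Y.T Γ A)

theorem map_castT {Γ : List S} {A B : S} (h : A = B) (t : X.T Γ A) :
    f Γ B (X.castT h t) = Y.castT h (f Γ A t) := by
  subst h; rfl

theorem map_castCtx {Γ Γ' : List S} {A : S} (h : Γ = Γ') (t : X.T Γ A) :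
    f Γ' A (X.castCtx h t) = Y.castCtx h (f Γ A t) := by
  subst h; rfl

end CloneData

namespace IsCloneHom

variable {S : Type} {X Y : CloneData S} {f : ∀ (Γ : List S) (A : S), X.T Γ A → Y.T Γ A}

theorem comp {Z : CloneData S} {g : ∀ (Γ : List S) (A : S), Y.T Γ A → Z.T Γ A}
    (hg : IsCloneHom Y Z g) (hf : IsCloneHom X Y f) :
    IsCloneHom X Z fun Γ A t => g Γ A (f Γ A t) :=
  ⟨fun Γ i => (congrArg (g Γ _) (hf.1 Γ i)).trans (hg.1 Γ i),
    fun Γ Δ A t σ => (congrArg (g Γ A) (hf.2 Γ Δ A t σ)).trans (hg.2 _ _ _ _ _)⟩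

theorem map_wkVar (hf : IsCloneHom X Y f) (Γ Ξ : List S) (i : Fin Γ.length) :
    f (Γ ++ Ξ) (Γ.get i) (X.wkVar Γ Ξ i) = Y.wkVar Γ Ξ i := by
  unfold CloneData.wkVar
  rw [CloneData.map_castT f, hf.1]

theorem map_liftSub (hf : IsCloneHom X Y f) {Ξ Γ : List S} (σ : X.Sub Ξ Γ) (Δ : List S)
    (j : Fin (Γ ++ Δ).length) :
    f (Ξ ++ Δ) ((Γ ++ Δ).get j) (X.liftSub σ Δ j) =
      Y.liftSub (fun i => f Ξ (Γ.get i) (σ i)) Δ j := by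
  unfold CloneData.liftSub
  split_ifs with h
  · rw [CloneData.map_castT f, hf.2]
    simp only [hf.map_wkVar]
  · rw [CloneData.map_castT f, hf.1]

end IsCloneHom

theorem IsAlgHom.map_semSO {S : Type} {Sg : SOSig S} {X Y : CloneData S} {IX : OpInterp Sg X}
    {IY : OpInterp Sg Y} {f : ∀ (Γ : List S) (A : S), X.T Γ A → Y.T Γ A}
    (hf : IsAlgHom X Y IX IY f) {Ψ : MCtx S} (Γ : List S)
    (ρ : (k : Fin Ψ.length) → X.T (Γ ++ (Ψ.get k).1) ((Ψ.get k).2)) {Ξ : List S} {B : S}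
    (t : SOTerm Sg Ψ Ξ B) :
    f (Γ ++ Ξ) B (semSO X IX Γ ρ t) = semSO Y IY Γ (fun k => f _ _ (ρ k)) t := by
  induction t with
  | var i =>
    simp only [semSO]
    rw [CloneData.map_castT f, hf.1.1]
  | mvar k args ih =>
    simp only [semSO]
    rw [hf.1.2]
    congr 1
    funext j
    split_ifs with h
    · rw [CloneData.map_castT f, hf.1.1]
    · rw [CloneData.map_castT f, ih]
  | op o args ih =>
    simp only [semSO]
    rw [hf.2]
    congr 1
    funext i
    rw [CloneData.map_castCtx f, ih]

namespace IsPredicate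

variable {S : Type} {Y : CloneData S} {R : ∀ (Γ : List S) (A : S), Set (Y.T Γ A)}

/-- The subclone of `Y` carved out by a predicate. -/
def subclone (hR : IsPredicate Y R) : CloneData S where
  T Γ A := R Γ A
  varC Γ i := ⟨Y.varC Γ i, hR.1 Γ i⟩
  substC t σ := ⟨Y.substC t.1 (fun i => (σ i).1), hR.2 _ _ _ _ _ t.2 (fun j => (σ j).2)⟩

/-- The inclusion of a subclone. -/
def incl (hR : IsPredicate Y R) (Γ : List S) (A : S) (t : hR.subclone.T Γ A) : Y.T Γ A :=
  Subtype.val t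

theorem incl_injective (hR : IsPredicate Y R) (Γ : List S) (A : S) :
    Function.Injective (hR.incl Γ A) :=
  Subtype.val_injective

theorem isCloneHom_incl (hR : IsPredicate Y R) : IsCloneHom hR.subclone Y hR.incl :=
  ⟨fun _ _ => rfl, fun _ _ _ _ _ => rfl⟩

theorem isClone_subclone (hR : IsPredicate Y R) (hY : IsClone Y) : IsClone hR.subclone :=
  ⟨fun _ _ i σ => Subtype.ext (hY.1 _ _ i fun i => (σ i).1),
    fun _ _ t => Subtype.ext (hY.2.1 _ _ t.1),
    fun _ _ _ _ t σ' σ =>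
      Subtype.ext (hY.2.2 _ _ _ _ t.1 (fun i => (σ' i).1) fun i => (σ i).1)⟩

variable {Sg : SOSig S} {I : OpInterp Sg Y}

/-- The operators of `Y` restricted to a predicate that they preserve. -/
def subInterp (hR : IsPredicate Y R)
    (hI : ∀ (Φ : MCtx S) (B : S) (o : Sg.ops Φ B) (Γ : List S)
      (ts : (i : Fin Φ.length) → Y.T (Γ ++ (Φ.get i).1) ((Φ.get i).2)),
      (∀ i, ts i ∈ R (Γ ++ (Φ.get i).1) ((Φ.get i).2)) → I Φ B o Γ ts ∈ R Γ B) :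
    OpInterp Sg hR.subclone :=
  fun Φ B o Γ ts => ⟨I Φ B o Γ fun i => (ts i).1, hI Φ B o Γ _ fun i => (ts i).2⟩

end IsPredicate

namespace IsAlgHom

variable {S : Type} {X Y Z : CloneData S}

theorem opsCommute_of_injective {Sg : SOSig S} {IX : OpInterp Sg X} {IY : OpInterp Sg Y}
    {f : ∀ (Γ : List S) (A : S), X.T Γ A → Y.T Γ A} (hf : IsAlgHom X Y IX IY f)
    (hinj : ∀ Γ A, Function.Injective (f Γ A)) (hY : OpsCommute Y IY) : OpsCommute X IX := by
  intro Φ B o Γ Ξ σ ts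
  apply hinj
  rw [hf.1.2, hf.2, hf.2, hY]
  congr 1
  funext i
  rw [hf.1.2]
  congr 1
  funext j
  exact (hf.1.map_liftSub σ _ j).symm

theorem satisfiesEqs_of_injective {P : SOPres S} {IX : OpInterp P.toSOSig X}
    {IY : OpInterp P.toSOSig Y} {f : ∀ (Γ : List S) (A : S), X.T Γ A → Y.T Γ A}
    (hf : IsAlgHom X Y IX IY f) (hinj : ∀ Γ A, Function.Injective (f Γ A))
    (hY : SatisfiesEqs P Y IY) : SatisfiesEqs P X IX := by
  intro Ψ B t u htu Γ ρ
  apply hinj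
  rw [hf.map_semSO, hf.map_semSO]
  exact hY Ψ B t u htu Γ _

theorem comp {Sg : SOSig S} {IX : OpInterp Sg X} {IY : OpInterp Sg Y} {IZ : OpInterp Sg Z}
    {g : ∀ (Γ : List S) (A : S), Y.T Γ A → Z.T Γ A}
    {f : ∀ (Γ : List S) (A : S), X.T Γ A → Y.T Γ A}
    (hg : IsAlgHom Y Z IY IZ g) (hf : IsAlgHom X Y IX IY f) :
    IsAlgHom X Z IX IZ fun Γ A t => g Γ A (f Γ A t) :=
  ⟨hg.1.comp hf.1,
    fun Φ B o Γ ts => (congrArg (g Γ B) (hf.2 Φ B o Γ ts)).trans (hg.2 _ _ _ _ _)⟩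

end IsAlgHom

/-- Induction for free algebras: a predicate preserved by the operators and containing the image
of the generators contains the image of every free term. -/
theorem IsFreeAlgebra.map_mem_of_isPredicate {S : Type} {P : SOPres S} {X Y F : CloneData S}
    {IY : OpInterp P.toSOSig Y} {IF : OpInterp P.toSOSig F}
    {η : ∀ (Γ : List S) (A : S), X.T Γ A → F.T Γ A} (hF : IsFreeAlgebra P X F IF η)
    (hY : IsClone Y) (hYc : OpsCommute Y IY) (hYe : SatisfiesEqs P Y IY)
    {g : ∀ (Γ : List S) (A : S), F.T Γ A → Y.T Γ A} (hg : IsAlgHom F Y IF IY g)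
    {R : ∀ (Γ : List S) (A : S), Set (Y.T Γ A)} (hR : IsPredicate Y R)
    (hI : ∀ (Φ : MCtx S) (B : S) (o : P.ops Φ B) (Γ : List S)
      (ts : (i : Fin Φ.length) → Y.T (Γ ++ (Φ.get i).1) ((Φ.get i).2)),
      (∀ i, ts i ∈ R (Γ ++ (Φ.get i).1) ((Φ.get i).2)) → IY Φ B o Γ ts ∈ R Γ B)
    (hη : ∀ Γ A t, g Γ A (η Γ A t) ∈ R Γ A) (Γ : List S) (A : S) (t : F.T Γ A) :
    g Γ A t ∈ R Γ A := by
  have hincl : IsAlgHom hR.subclone Y (hR.subInterp hI) IY hR.incl :=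
    ⟨hR.isCloneHom_incl, fun _ _ _ _ _ => rfl⟩
  have hgη : IsCloneHom X Y fun Γ A t => g Γ A (η Γ A t) :=
    hg.1.comp hF.2.2.2.1
  obtain ⟨k, ⟨hk, hkη⟩, -⟩ := hF.2.2.2.2 hR.subclone (hR.subInterp hI) (hR.isClone_subclone hY)
    (hincl.opsCommute_of_injective hR.incl_injective hYc)
    (hincl.satisfiesEqs_of_injective hR.incl_injective hYe)
    (fun Γ A t => ⟨g Γ A (η Γ A t), hη Γ A t⟩)
    ⟨fun Γ i => Subtype.ext (hgη.1 Γ i), fun Γ Δ A t σ => Subtype.ext (hgη.2 Γ Δ A t σ)⟩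
  have hgk : g = fun Γ A t => hR.incl Γ A (k Γ A t) :=
    (hF.2.2.2.2 Y IY hY hYc hYe _ hgη).unique ⟨hg, fun _ _ _ => rfl⟩
      ⟨hincl.comp hk, fun Γ A t => by rw [hkη]; rfl⟩
  rw [hgk]
  exact (k Γ A t).2

theorem isPredicate_openLift {S : Type} {Y : CloneData S} (hY : IsClone Y)
    (Q : ∀ (Γ : List S) (A : S), Set (Y.T Γ A)) : IsPredicate Y (openLift Y Q) := by
  refine ⟨fun Γ i Δ σ hσ => ?_, fun Γ Δ B t σ ht hσ Ξ τ hτ => ?_⟩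
  · rw [hY.1]
    exact hσ i
  · rw [← hY.2.2]
    exact ht Ξ _ fun j => hσ j Ξ τ hτ

theorem openLift_subset {S : Type} {Y : CloneData S} (hY : IsClone Y)
    {Q : ∀ (Γ : List S) (A : S), Set (Y.T Γ A)}
    (hvar : ∀ (Γ : List S) (i : Fin Γ.length), Y.varC Γ i ∈ Q Γ (Γ.get i)) (Γ : List S) (A : S) :
    openLift Y Q Γ A ⊆ Q Γ A := fun t ht => by
  simpa only [hY.2.1] using ht Γ (Y.varC Γ) (hvar Γ)

/-- Induction principle for open terms: for a family of subsets `Q` containing the variables,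
if the interpreted operators preserve `Q^∘` and `f : X → Y` lands in `Q^∘`, then the extension
`f̂ : F_P X → Y` maps every term of the free `P`-algebra into `Q`. -/
theorem induction_open_terms {S : Type} (P : SOPres S)
    (Y : CloneData S) (IY : OpInterp P.toSOSig Y)
    (hY : IsClone Y) (hYc : OpsCommute Y IY) (hYe : SatisfiesEqs P Y IY)
    (Q : ∀ (Γ : List S) (A : S), Set (Y.T Γ A))
    (X : CloneData S) (hX : IsClone X)
    (f : ∀ (Γ : List S) (A : S), X.T Γ A → Y.T Γ A) (hf : IsCloneHom X Y f)
    (F : CloneData S) (IF : OpInterp P.toSOSig F)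
    (η : ∀ (Γ : List S) (A : S), X.T Γ A → F.T Γ A)
    (hF : IsFreeAlgebra P X F IF η)
    (g : ∀ (Γ : List S) (A : S), F.T Γ A → Y.T Γ A)
    (hg : IsAlgHom F Y IF IY g) (hgη : ∀ Γ A t, g Γ A (η Γ A t) = f Γ A t)
    (hvar : ∀ (Γ : List S) (i : Fin Γ.length), Y.varC Γ i ∈ Q Γ (Γ.get i))
    (hops : ∀ (Φ : MCtx S) (B : S) (o : P.ops Φ B) (Γ : List S)
      (ts : (i : Fin Φ.length) → Y.T (Γ ++ (Φ.get i).1) ((Φ.get i).2)),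
      (∀ i, ts i ∈ openLift Y Q (Γ ++ (Φ.get i).1) ((Φ.get i).2)) →
        IY Φ B o Γ ts ∈ openLift Y Q Γ B)
    (hfQ : ∀ (Γ : List S) (B : S) (t : X.T Γ B), f Γ B t ∈ openLift Y Q Γ B) :
    ∀ (Γ : List S) (A : S) (t : F.T Γ A), g Γ A t ∈ Q Γ A := by
  intro Γ A t
  refine openLift_subset hY hvar Γ A ?_
  exact hF.map_mem_of_isPredicate hY hYc hYe hg (isPredicate_openLift hY Q) hops
    (fun Γ A t => hgη Γ A t ▸ hfQ Γ A t) Γ A t
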